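/- For every α > 0 with α ≠ 1 and every x₀ > 0 there exist θ* > 0 and I* > 0 such that for all 0 < θ < θ*: if α > 1 then M_{x₀} ≤ θ^(1/α) · I*, and if 0 < α < 1 then M_{x₀} ≤ θ · I*. -/

import Mathlib

open MeasureTheory Set Filter Topology

noncomputable section

/-- The wave speed profile `c(x) = (1 + θ (x₊)^α)^(-1/2)`. -/
def spd (α θ x : ℝ) : ℝ := (1 + θ * (max x 0) ^ α) ^ (-(1 / 2) : ℝ)

/-- The WKB amplitude `b(x) = c(x)^(1/2)`. -/
def amp (α θ x : ℝ) : ℝ := spd α θ x ^ ((1 : ℝ) / 2)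

/-- The WKB phase `φ(x) = ∫₀ˣ c(y)⁻¹ dy`. -/
def phase (α θ x : ℝ) : ℝ := ∫ y in (0:ℝ)..x, (spd α θ y)⁻¹

/-- `M(x) = c(x)^(1/2) (c^(1/2))''(x)` for `x > 0`, and `0` for `x ≤ 0`. -/
def Mfun (α θ x : ℝ) : ℝ :=
  if 0 < x then
    spd α θ x ^ ((1 : ℝ) / 2) * deriv (deriv (fun y => spd α θ y ^ ((1 : ℝ) / 2))) x
  else 0

/-- `M_{x₀} = ∫_{x₀}^∞ |M(x)| dx`. -/
def Mtail (α θ x₀ : ℝ) : ℝ := ∫ x in Ioi x₀, |Mfun α θ x|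

/-- The Volterra operator `K_σ`. -/
def Kop (α θ x₀ σ : ℝ) (f : ℝ → ℂ) (x : ℝ) : ℂ :=
  (2 * Complex.I * (1 + Complex.I * (σ : ℂ)))⁻¹ *
    ((∫ y in x₀..x, (Mfun α θ y : ℂ) * f y *
        Complex.exp (-2 * Complex.I * (1 + Complex.I * (σ : ℂ)) *
          ((phase α θ x - phase α θ y : ℝ) : ℂ))) +
      ∫ y in Ioi x, (Mfun α θ y : ℂ) * f y)

/-- The right-going WKB wave `v^> = b e^{-iφ}`. -/
def vplus (α θ x : ℝ) : ℂ := (amp α θ x : ℂ) * Complex.exp (-Complex.I * (phase α θ x : ℂ))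

/-- The left-going WKB wave `v^< = b e^{iφ}`. -/
def vminus (α θ x : ℝ) : ℂ := (amp α θ x : ℂ) * Complex.exp (Complex.I * (phase α θ x : ℂ))

/-- `S` is a bounded continuous solution on `[x₀,∞)` of `S = e^{-2iφ} + K₀ S`. -/
def IsVolterraSol (α θ x₀ : ℝ) (S : ℝ → ℂ) : Prop :=
  (∃ C, ∀ x ∈ Ici x₀, ‖S x‖ ≤ C) ∧ ContinuousOn S (Ici x₀) ∧
    ∀ x ∈ Ici x₀, S x = Complex.exp (-2 * Complex.I * (phase α θ x : ℂ)) + Kop α θ x₀ 0 S x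

/-- `R_{x₀} = (2i)⁻¹ ∫_{x₀}^∞ M S^>`. -/
def Rx (α θ x₀ : ℝ) (S : ℝ → ℂ) : ℂ :=
  (2 * Complex.I)⁻¹ * ∫ x in Ioi x₀, (Mfun α θ x : ℂ) * S x

lemma spd_rpow_half {α θ : ℝ} (hθ : 0 < θ) {x : ℝ} (hx : 0 < x) :
    spd α θ x ^ ((1 : ℝ) / 2) = (1 + θ * x ^ α) ^ (-(1 / 4) : ℝ) := by
  have hw : 0 ≤ 1 + θ * x ^ α := by positivity
  rw [spd, max_eq_left hx.le, ← Real.rpow_mul hw]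
  norm_num

lemma hasDerivAt_one_add_mul_rpow (α θ : ℝ) {x : ℝ} (hx : 0 < x) :
    HasDerivAt (fun y : ℝ => 1 + θ * y ^ α) (θ * (α * x ^ (α - 1))) x :=
  ((Real.hasDerivAt_rpow_const (Or.inl hx.ne')).const_mul θ).const_add 1

lemma hasDerivAt_one_add_mul_rpow_rpow (α p : ℝ) {θ x : ℝ} (hθ : 0 < θ) (hx : 0 < x) :
    HasDerivAt (fun y : ℝ => (1 + θ * y ^ α) ^ p)
      (θ * (α * x ^ (α - 1)) * p * (1 + θ * x ^ α) ^ (p - 1)) x :=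
  (hasDerivAt_one_add_mul_rpow α θ hx).rpow_const (Or.inl (by positivity))

lemma deriv_deriv_spd_rpow_half (α : ℝ) {θ x : ℝ} (hθ : 0 < θ) (hx : 0 < x) :
    deriv (deriv (fun y => spd α θ y ^ ((1 : ℝ) / 2))) x =
      θ * (α * ((α - 1) * x ^ (α - 1 - 1))) * (-(1 / 4)) *
          (1 + θ * x ^ α) ^ (-(1 / 4) - 1 : ℝ) +
        θ * (α * x ^ (α - 1)) * (-(1 / 4)) *
          (θ * (α * x ^ (α - 1)) * (-(1 / 4) - 1) *
            (1 + θ * x ^ α) ^ (-(1 / 4) - 1 - 1 : ℝ)) := by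
  have h1 : deriv (fun y => spd α θ y ^ ((1 : ℝ) / 2)) =ᶠ[𝓝 x]
      fun y => θ * (α * y ^ (α - 1)) * (-(1 / 4)) * (1 + θ * y ^ α) ^ (-(1 / 4) - 1 : ℝ) := by
    filter_upwards [Ioi_mem_nhds hx] with y hy
    have h2 : (fun y => spd α θ y ^ ((1 : ℝ) / 2)) =ᶠ[𝓝 y]
        fun y => (1 + θ * y ^ α) ^ (-(1 / 4) : ℝ) := by
      filter_upwards [Ioi_mem_nhds hy] with z hz using spd_rpow_half hθ hz
    rw [h2.deriv_eq]
    exact (hasDerivAt_one_add_mul_rpow_rpow α _ hθ hy).deriv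
  rw [h1.deriv_eq]
  have hpow : HasDerivAt (fun y : ℝ => y ^ (α - 1)) ((α - 1) * x ^ (α - 1 - 1)) x :=
    Real.hasDerivAt_rpow_const (Or.inl hx.ne')
  exact ((((hpow.const_mul α).const_mul θ).mul_const (-(1 / 4))).mul
    (hasDerivAt_one_add_mul_rpow_rpow α _ hθ hx)).deriv

lemma Mfun_eq (α : ℝ) {θ x : ℝ} (hθ : 0 < θ) (hx : 0 < x) :
    Mfun α θ x =
      (5 / 16 * α ^ 2 * ((θ * x ^ α) ^ 2 * (1 + θ * x ^ α) ^ (-(5 / 2) : ℝ)) -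
        1 / 4 * (α * (α - 1)) * (θ * x ^ α * (1 + θ * x ^ α) ^ (-(3 / 2) : ℝ))) / x ^ 2 := by
  have hw : 0 < 1 + θ * x ^ α := by positivity
  have e1 : (1 + θ * x ^ α) ^ (-(3 / 2) : ℝ) =
      (1 + θ * x ^ α) ^ (-(1 / 4) : ℝ) * (1 + θ * x ^ α) ^ (-(1 / 4) - 1 : ℝ) := by
    rw [← Real.rpow_add hw]; norm_num
  have e2 : (1 + θ * x ^ α) ^ (-(5 / 2) : ℝ) =
      (1 + θ * x ^ α) ^ (-(1 / 4) : ℝ) * (1 + θ * x ^ α) ^ (-(1 / 4) - 1 - 1 : ℝ) := by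
    rw [← Real.rpow_add hw]; norm_num
  rw [Mfun, if_pos hx, deriv_deriv_spd_rpow_half α hθ hx, spd_rpow_half hθ hx, e1, e2,
    Real.rpow_sub_one hx.ne' (α - 1), Real.rpow_sub_one hx.ne' α]
  field_simp
  ring

lemma abs_Mfun_le {α θ x : ℝ} (hα : 0 < α) (hθ : 0 < θ) (hx : 0 < x) :
    |Mfun α θ x| ≤
      (5 / 16 * α ^ 2 + 1 / 4 * (α * |α - 1|)) * (min (θ * x ^ α) 1 / x ^ 2) := by
  rw [Mfun_eq α hθ hx]
  have hu : 0 < θ * x ^ α := by positivity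
  set u := θ * x ^ α
  have h1 : (1 + u) ^ (-(5 / 2) : ℝ) ≤ ((1 + u) ^ 2)⁻¹ := by
    rw [← Real.rpow_natCast, ← Real.rpow_neg (by positivity)]
    exact Real.rpow_le_rpow_of_exponent_le (by linarith) (by norm_num)
  have h2 : (1 + u) ^ (-(3 / 2) : ℝ) ≤ (1 + u)⁻¹ := by
    rw [← Real.rpow_neg_one]
    exact Real.rpow_le_rpow_of_exponent_le (by linarith) (by norm_num)
  have hA : u ^ 2 * (1 + u) ^ (-(5 / 2) : ℝ) ≤ min u 1 := by
    refine (mul_le_mul_of_nonneg_left h1 (by positivity)).trans ?_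
    rw [← div_eq_mul_inv, div_le_iff₀ (by positivity)]
    rcases min_cases u 1 with ⟨h, -⟩ | ⟨h, -⟩ <;> rw [h] <;> nlinarith [pow_pos hu 3]
  have hB : u * (1 + u) ^ (-(3 / 2) : ℝ) ≤ min u 1 := by
    refine (mul_le_mul_of_nonneg_left h2 hu.le).trans ?_
    rw [← div_eq_mul_inv, div_le_iff₀ (by positivity)]
    rcases min_cases u 1 with ⟨h, -⟩ | ⟨h, -⟩ <;> rw [h] <;> nlinarith
  rw [abs_div, abs_of_pos (pow_pos hx 2), ← mul_div_assoc]
  gcongr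
  refine (abs_sub _ _).trans ?_
  have hA0 : 0 ≤ u ^ 2 * (1 + u) ^ (-(5 / 2) : ℝ) := by positivity
  have hB0 : 0 ≤ u * (1 + u) ^ (-(3 / 2) : ℝ) := by positivity
  rw [abs_mul, abs_mul _ (u * _), abs_of_nonneg hA0, abs_of_nonneg hB0, abs_mul (1 / 4),
    abs_mul α, abs_of_pos hα, abs_of_nonneg (by positivity : 0 ≤ 5 / 16 * α ^ 2),
    abs_of_pos (by norm_num : (0 : ℝ) < 1 / 4), add_mul]
  gcongr

lemma Mtail_le_of_integrableOn {α θ x₀ : ℝ} (hα : 0 < α) (hθ : 0 < θ) (hx₀ : 0 < x₀)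
    {g : ℝ → ℝ} (hg : IntegrableOn g (Ioi x₀))
    (hle : ∀ x ∈ Ioi x₀, min (θ * x ^ α) 1 / x ^ 2 ≤ g x) :
    Mtail α θ x₀ ≤ (5 / 16 * α ^ 2 + 1 / 4 * (α * |α - 1|)) * ∫ x in Ioi x₀, g x := by
  rw [Mtail, ← integral_const_mul]
  refine integral_mono_of_nonneg (ae_of_all _ fun x => abs_nonneg _) (hg.const_mul _) ?_
  filter_upwards [ae_restrict_mem measurableSet_Ioi] with x hx
  exact (abs_Mfun_le hα hθ (hx₀.trans hx)).trans
    (mul_le_mul_of_nonneg_left (hle x hx) (by positivity))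

lemma mul_rpow_div_sq {α θ x : ℝ} (hx : 0 < x) :
    θ * x ^ α / x ^ 2 = θ * x ^ (α - 2) := by
  rw [Real.rpow_sub hx, Real.rpow_two, mul_div_assoc]

lemma Mtail_le_of_lt_one {α θ x₀ : ℝ} (hα : 0 < α) (hα1 : α < 1) (hθ : 0 < θ) (hx₀ : 0 < x₀) :
    Mtail α θ x₀ ≤
      (5 / 16 * α ^ 2 + 1 / 4 * (α * |α - 1|)) * (θ * (x₀ ^ (α - 1) / (1 - α))) := by
  have hf : IntegrableOn (fun x : ℝ => x ^ (α - 2)) (Ioi x₀) :=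
    integrableOn_Ioi_rpow_of_lt (by linarith) hx₀
  refine (Mtail_le_of_integrableOn hα hθ hx₀ (hf.const_mul θ) fun x hx => ?_).trans_eq ?_
  · rw [← mul_rpow_div_sq (hx₀.trans hx)]
    gcongr
    exact min_le_left _ _
  · rw [integral_const_mul, integral_Ioi_rpow_of_lt (by linarith) hx₀,
      show α - 2 + 1 = -(1 - α) by ring, neg_div_neg_eq, neg_sub]

lemma Mtail_le_of_one_lt {α θ x₀ : ℝ} (hα1 : 1 < α) (hθ : 0 < θ) (hx₀ : 0 < x₀) :
    Mtail α θ x₀ ≤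
      (5 / 16 * α ^ 2 + 1 / 4 * (α * |α - 1|)) * (θ ^ (1 / α) * (1 / (α - 1) + 1)) := by
  have hα : 0 < α := by linarith
  set A : ℝ := θ ^ (-(1 / α)) with hA
  have hA0 : 0 < A := by positivity
  let g : ℝ → ℝ := fun x =>
    (Ioc 0 A).indicator (fun x => θ * x ^ (α - 2)) x + (Ioi A).indicator (fun x => x ^ (-2 : ℝ)) x
  have hf1 : IntegrableOn (fun x : ℝ => θ * x ^ (α - 2)) (Ioc 0 A) :=
    ((intervalIntegrable_iff_integrableOn_Ioc_of_le hA0.le).1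
      (intervalIntegral.intervalIntegrable_rpow' (by linarith))).const_mul θ
  have hf2 : IntegrableOn (fun x : ℝ => x ^ (-2 : ℝ)) (Ioi A) :=
    integrableOn_Ioi_rpow_of_lt (by norm_num) hA0
  have hi1 := hf1.integrable_indicator measurableSet_Ioc
  have hi2 := hf2.integrable_indicator measurableSet_Ioi
  have hg : Integrable g := hi1.add hi2
  have hg0 : ∀ x, 0 ≤ g x := fun x => by
    refine add_nonneg (indicator_nonneg (fun y hy => ?_) x) (indicator_nonneg (fun y hy => ?_) x)
    · have := hy.1
      positivity
    · have := hA0.trans hy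
      positivity
  have hg_eq : ∫ x, g x = θ ^ (1 / α) * (1 / (α - 1) + 1) := by
    rw [integral_add hi1 hi2, integral_indicator measurableSet_Ioc,
      integral_indicator measurableSet_Ioi, integral_Ioi_rpow_of_lt (by norm_num) hA0,
      integral_const_mul, ← intervalIntegral.integral_of_le hA0.le,
      integral_rpow (Or.inl (by linarith)), show α - 2 + 1 = α - 1 by ring,
      Real.zero_rpow (by linarith), sub_zero]
    have h1 : θ * A ^ (α - 1) = θ ^ (1 / α) := by
      rw [hA, ← Real.rpow_mul hθ.le, ← Real.rpow_one_add' hθ.le]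
      · congr 1
        field_simp
        ring
      · rw [show 1 + -(1 / α) * (α - 1) = 1 / α by field_simp; ring]
        positivity
    have h2 : A ^ (-2 + 1 : ℝ) = θ ^ (1 / α) := by
      rw [hA, ← Real.rpow_mul hθ.le]
      norm_num
    rw [← mul_div_assoc, h1, h2]
    ring
  refine (Mtail_le_of_integrableOn hα hθ hx₀ hg.integrableOn fun x hx => ?_).trans ?_
  · have hx0 : 0 < x := hx₀.trans hx
    rcases le_or_gt x A with h | h
    · simp only [g]
      rw [indicator_of_mem (show x ∈ Ioc 0 A from ⟨hx0, h⟩),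
        indicator_of_notMem (show x ∉ Ioi A from not_lt.2 h), add_zero, ← mul_rpow_div_sq hx0]
      gcongr
      exact min_le_left _ _
    · simp only [g]
      rw [indicator_of_notMem (show x ∉ Ioc 0 A from fun h' => h.not_ge h'.2),
        indicator_of_mem (show x ∈ Ioi A from h), zero_add, Real.rpow_neg hx0.le, Real.rpow_two,
        inv_eq_one_div]
      gcongr
      exact min_le_right _ _
  · rw [← hg_eq]
    exact mul_le_mul_of_nonneg_left (setIntegral_le_integral hg (ae_of_all _ hg0)) (by positivity)

/-- quantitative bounds on `M_{x₀}`. -/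
theorem stmt14 (α x₀ : ℝ) (hα : 0 < α) (hα1 : α ≠ 1) (hx₀ : 0 < x₀) :
    ∃ θstar > (0:ℝ), ∃ Istar > (0:ℝ), ∀ θ : ℝ, 0 < θ → θ < θstar →
      (1 < α → Mtail α θ x₀ ≤ θ ^ (1 / α) * Istar) ∧
      (α < 1 → Mtail α θ x₀ ≤ θ * Istar) := by
  rcases lt_or_gt_of_ne hα1 with h | h
  · have h' : 0 < 1 - α := sub_pos.2 h
    refine ⟨1, one_pos, (5 / 16 * α ^ 2 + 1 / 4 * (α * |α - 1|)) * (x₀ ^ (α - 1) / (1 - α)),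
      by positivity, fun θ hθ _ => ⟨fun h1 => absurd h1 h.not_gt, fun _ => ?_⟩⟩
    rw [mul_left_comm]
    exact Mtail_le_of_lt_one hα h hθ hx₀
  · have h' : 0 < α - 1 := sub_pos.2 h
    refine ⟨1, one_pos, (5 / 16 * α ^ 2 + 1 / 4 * (α * |α - 1|)) * (1 / (α - 1) + 1),
      by positivity, fun θ hθ _ => ⟨fun _ => ?_, fun h1 => absurd h1 h.not_gt⟩⟩
    rw [mul_left_comm]
    exact Mtail_le_of_one_lt h hθ hx₀
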